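/- arXiv:0710.3270 — 2 statements merged into one kernel-verified Lean document; each statement's English description precedes it below -/
import Mathlib

section
/- Fix a real parameter s and consider, in the Hilbert space L²((0,∞), r dr), the differential operator T with domain the smooth compactly supported functions C₀^∞((0,∞)), acting by (Tf)(r) = −(1/r)(d/dr)(r (df/dr))(r) + (1/r²)(s + r²/2)² f(r). Then T is a symmetric densely defined operator, and T is essentially self-adjoint (i.e., the closure of T is self-adjoint) if and only if |s| ≥ 1. -/
open MeasureTheory
open scoped ComplexInnerProductSpace

noncomputable section
/-- The measure `r dr` on the half-line `(0,∞)`. -/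
def radialMeasure : Measure ℝ :=
  (volume.restrict (Set.Ioi (0 : ℝ))).withDensity (fun r => ENNReal.ofReal r)

/-- `f` is a test function: smooth, compactly supported in `(0,∞)`. -/
def IsTestFun (f : ℝ → ℂ) : Prop :=
  ContDiff ℝ (⊤ : ℕ∞) f ∧ HasCompactSupport f ∧ tsupport f ⊆ Set.Ioi (0 : ℝ)

/-- The differential expression `(Tf)(r) = -(1/r)(r f')' (r) + (1/r²)(s + r²/2)² f(r)`. -/
def diffExpr (s : ℝ) (f : ℝ → ℂ) (r : ℝ) : ℂ :=
  -(1 / (r : ℂ)) * deriv (fun x : ℝ => (x : ℂ) * deriv f x) r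
    + (1 / (r : ℂ) ^ 2) * ((s : ℂ) + (r : ℂ) ^ 2 / 2) ^ 2 * f r

lemma mem_adjoint_graph_iff' {E : Type*} [NormedAddCommGroup E] [InnerProductSpace ℂ E]
    [CompleteSpace E] (T : E →ₗ.[ℂ] E) (hd : Dense (T.domain : Set E)) (y k : E) :
    (y, k) ∈ T.adjoint.graph ↔ ∀ x : T.domain, ⟪k, (x : E)⟫ = ⟪y, T x⟫ := by
  rw [LinearPMap.mem_graph_iff]
  constructor
  · rintro ⟨z, hz, hk⟩ x
    simp only at hz hk
    rw [← hz, ← hk]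
    exact LinearPMap.adjoint_isFormalAdjoint hd z x
  · intro h
    have hm := LinearPMap.mem_adjoint_domain_of_exists (T := T) y ⟨k, h⟩
    exact ⟨⟨y, hm⟩, rfl, LinearPMap.adjoint_apply_eq hd ⟨y, hm⟩ h⟩

lemma abstract_esa {E : Type*} [NormedAddCommGroup E] [InnerProductSpace ℂ E]
    [CompleteSpace E] (T : E →ₗ.[ℂ] E) (hd : Dense (T.domain : Set E))
    (hsym : ∀ x y : T.domain, ⟪T x, (y : E)⟫ = ⟪(x : E), T y⟫)
    (hpos : ∀ x : T.domain, 0 ≤ (⟪T x, (x : E)⟫).re) :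
    T.adjoint = T.closure ↔
      ∀ g : E, (∀ x : T.domain, ⟪g, T x + (x : E)⟫ = 0) → g = 0 := by
  have hle : T ≤ T.adjoint := LinearPMap.IsFormalAdjoint.le_adjoint hd hsym
  have hcl : T.IsClosable :=
    (LinearPMap.adjoint_isClosed hd).isClosable.leIsClosable hle
  have hgr := hcl.graph_closure_eq_closure_graph
  constructor
  · intro h g hg
    have h1 : (g, -g) ∈ T.adjoint.graph := by
      rw [mem_adjoint_graph_iff' T hd]
      intro x
      have := hg x
      rw [inner_add_right] at this
      rw [inner_neg_left]
      exact (eq_neg_of_add_eq_zero_left this).symm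
    rw [h, ← hgr] at h1
    have hC : _root_.IsClosed {p : E × E | 0 ≤ (⟪p.2, p.1⟫).re} :=
      isClosed_le continuous_const (by fun_prop)
    have hsub : (T.graph : Set (E × E)) ⊆ {p : E × E | 0 ≤ (⟪p.2, p.1⟫).re} := by
      rintro ⟨a, b⟩ hab
      obtain ⟨z, hz, hk⟩ := (LinearPMap.mem_graph_iff _).1 hab
      simp only at hz hk
      simp only [Set.mem_setOf_eq, ← hz, ← hk]
      exact hpos z
    have h2 := closure_minimal hsub hC h1
    simp only [Set.mem_setOf_eq, inner_neg_left, Complex.neg_re] at h2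
    have h3 : (⟪g, g⟫).re = ‖g‖ ^ 2 := by
      have := inner_self_eq_norm_sq (𝕜 := ℂ) g
      simpa using this
    rw [h3] at h2
    have : ‖g‖ ^ 2 = 0 := le_antisymm (by linarith) (by positivity)
    simpa using this
  · intro h
    apply LinearPMap.eq_of_eq_graph
    apply le_antisymm
    · rintro ⟨y, k⟩ hyk
      rw [mem_adjoint_graph_iff' T hd] at hyk
      rw [← hgr]
      let S : T.domain →ₗ[ℂ] E := T.toFun + T.domain.subtype
      have hS : ∀ x : T.domain, S x = T x + (x : E) := fun x => rfl
      have hbd : ∀ x : T.domain, ‖(x : E)‖ ≤ ‖S x‖ := by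
        intro x
        have h3 : (⟪(x:E), x⟫).re = ‖(x:E)‖ ^ 2 := by
          have := inner_self_eq_norm_sq (𝕜 := ℂ) (x:E)
          simpa using this
        have h4 : ‖(x:E)‖^2 ≤ (⟪S x, (x:E)⟫).re := by
          rw [hS, inner_add_left, Complex.add_re, h3]
          linarith [hpos x]
        have h5 : (⟪S x, (x:E)⟫).re ≤ ‖S x‖ * ‖(x:E)‖ :=
          (Complex.re_le_norm _).trans (norm_inner_le_norm _ _)
        by_contra hc
        push Not at hc
        have : 0 < ‖(x:E)‖ := (norm_nonneg _).trans_lt hc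
        nlinarith
      have htop : (LinearMap.range S).topologicalClosure = ⊤ := by
        rw [Submodule.topologicalClosure_eq_top_iff, Submodule.eq_bot_iff]
        intro g hg
        apply h g
        intro x
        have := (Submodule.mem_orthogonal' _ _).1 hg (S x) ⟨x, rfl⟩
        exact this
      have hmem : k + y ∈ closure (LinearMap.range S : Set E) := by
        rw [← Submodule.topologicalClosure_coe, htop]; trivial
      obtain ⟨a, ha, hlim⟩ := mem_closure_iff_seq_limit.1 hmem
      choose x hx using ha
      have hcau : CauchySeq (fun n => ((x n : T.domain) : E)) := by
        rw [Metric.cauchySeq_iff']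
        intro ε hε
        obtain ⟨N, hN⟩ := Metric.cauchySeq_iff'.1 hlim.cauchySeq ε hε
        refine ⟨N, fun n hn => ?_⟩
        refine lt_of_le_of_lt ?_ (hN n hn)
        rw [dist_eq_norm, dist_eq_norm, ← hx n, ← hx N, ← map_sub]
        exact hbd (x n - x N)
      obtain ⟨x₀, hx₀⟩ := cauchySeq_tendsto_of_complete hcau
      have hT : Filter.Tendsto (fun n => T (x n)) Filter.atTop (nhds (k + y - x₀)) := by
        have := hlim.sub hx₀
        refine this.congr fun n => ?_
        rw [← hx n, hS]; abel
      have hin : (x₀, k + y - x₀) ∈ T.graph.topologicalClosure := by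
        have : (x₀, k + y - x₀) ∈ closure (T.graph : Set (E × E)) := by
          refine mem_closure_of_tendsto (hx₀.prodMk_nhds hT) (Filter.Eventually.of_forall fun n => ?_)
          exact T.mem_graph (x n)
        exact this
      have hin2 : (x₀, k + y - x₀) ∈ T.adjoint.graph := by
        have hc := LinearPMap.adjoint_isClosed hd
        exact (Submodule.topologicalClosure_minimal _ (LinearPMap.le_graph_of_le hle) hc) hin
      rw [mem_adjoint_graph_iff' T hd] at hin2
      have hz : x₀ - y = 0 := by
        apply h
        intro f
        have e1 := hyk f
        have e2 := hin2 f
        simp only [inner_sub_left, inner_add_left, inner_add_right] at *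
        rw [← e1, ← e2]; ring
      have : x₀ = y := sub_eq_zero.1 hz
      subst this
      simpa using hin
    · rw [← hgr]
      exact Submodule.topologicalClosure_minimal _ (LinearPMap.le_graph_of_le hle)
        (LinearPMap.adjoint_isClosed hd)

section helpers

open Set ComplexConjugate

lemma ae_rad_iff {P : ℝ → Prop} : (∀ᵐ r ∂radialMeasure, P r) ↔ ∀ᵐ r : ℝ, 0 < r → P r := by
  unfold radialMeasure
  rw [ae_withDensity_iff (by fun_prop), ae_restrict_iff' measurableSet_Ioi]
  refine Filter.eventually_congr (Filter.Eventually.of_forall fun r => ?_)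
  simp only [mem_Ioi, ne_eq, ENNReal.ofReal_eq_zero, not_le]
  tauto

lemma integral_rad (f : ℝ → ℂ) :
    ∫ r, f r ∂radialMeasure = ∫ r in Ioi (0:ℝ), (r:ℂ) * f r := by
  unfold radialMeasure
  rw [integral_withDensity_eq_integral_toReal_smul (by fun_prop) (by simp)]
  refine setIntegral_congr_fun measurableSet_Ioi fun r hr => ?_
  simp [ENNReal.toReal_ofReal (le_of_lt hr)]

lemma integrable_rad {f : ℝ → ℂ} :
    Integrable f radialMeasure ↔ IntegrableOn (fun r : ℝ => (r:ℂ) * f r) (Ioi (0:ℝ)) := by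
  unfold radialMeasure
  rw [integrable_withDensity_iff_integrable_smul' (by fun_prop) (by simp)]
  refine integrable_congr ?_
  filter_upwards [ae_restrict_mem measurableSet_Ioi] with r hr
  simp [ENNReal.toReal_ofReal (le_of_lt hr)]

instance : IsLocallyFiniteMeasure radialMeasure := by
  unfold radialMeasure
  exact IsLocallyFiniteMeasure.withDensity_ofReal continuous_id

lemma inner_rad (F G : Lp ℂ 2 radialMeasure) :
    ⟪F, G⟫ = ∫ r in Ioi (0:ℝ), (r:ℂ) * (conj (F r) * G r) := by
  rw [L2.inner_def, integral_rad]
  simp [RCLike.inner_apply, mul_comm]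

lemma inner_rad_int (F G : Lp ℂ 2 radialMeasure) :
    IntegrableOn (fun r : ℝ => (r:ℂ) * (conj (F r) * G r)) (Ioi (0:ℝ)) := by
  rw [← integrable_rad]
  have := L2.integrable_inner (𝕜 := ℂ) F G
  simpa [RCLike.inner_apply, mul_comm] using this

lemma ae_Ioi_of_rad {f g : ℝ → ℂ} (h : f =ᵐ[radialMeasure] g) :
    f =ᵐ[volume.restrict (Ioi (0:ℝ))] g := by
  rw [Filter.EventuallyEq, ae_restrict_iff' measurableSet_Ioi]
  exact ae_rad_iff.1 h

lemma int_deriv_zero {E : Type*} [NormedAddCommGroup E] [NormedSpace ℝ E] [CompleteSpace E]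
    {Q Q' : ℝ → E} {a b : ℝ} (ha : 0 < a) (hab : a < b)
    (hd : ∀ x > 0, HasDerivAt Q (Q' x) x) (hc : ContinuousOn Q' (Ioi 0))
    (h0 : ∀ x, x ∉ Ioo a b → Q x = 0 ∧ Q' x = 0) :
    IntegrableOn Q' (Ioi 0) ∧ ∫ x in Ioi (0:ℝ), Q' x = 0 := by
  have hs : Icc a b ⊆ Ioi 0 := fun x hx => lt_of_lt_of_le ha hx.1
  have h1 : IntegrableOn Q' (Icc a b) := (hc.mono hs).integrableOn_Icc
  have h1' : IntegrableOn Q' (Ioc a b) := h1.mono_set Ioc_subset_Icc_self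
  have hs' : Ioc a b ⊆ Ioi 0 := Ioc_subset_Icc_self.trans hs
  have hz : ∀ x ∈ Ioi (0:ℝ) \ Ioc a b, Q' x = 0 := fun x hx =>
    (h0 x fun h => hx.2 (Ioo_subset_Ioc_self h)).2
  refine ⟨h1'.of_forall_sdiff_eq_zero measurableSet_Ioi hz, ?_⟩
  rw [setIntegral_eq_of_subset_of_forall_sdiff_eq_zero measurableSet_Ioi hs' hz,
    ← intervalIntegral.integral_of_le hab.le,
    intervalIntegral.integral_eq_sub_of_hasDerivAt (f := Q)]
  · rw [(h0 a (by simp)).1, (h0 b (by simp)).1]; simp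
  · intro x hx
    rw [uIcc_of_le hab.le] at hx
    exact hd x (hs hx)
  · rw [intervalIntegrable_iff_integrableOn_Ioc_of_le hab.le]; exact h1'

lemma cpt_Ioo {K : Set ℝ} (hK : IsCompact K) (h : K ⊆ Ioi 0) :
    ∃ a b : ℝ, 0 < a ∧ a < b ∧ K ⊆ Ioo a b := by
  rcases K.eq_empty_or_nonempty with rfl | hne
  · exact ⟨1, 2, by norm_num, by norm_num, empty_subset _⟩
  · obtain ⟨m, hm, hm'⟩ := hK.exists_isLeast hne
    obtain ⟨M, hM, hM'⟩ := hK.exists_isGreatest hne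
    have h1 : 0 < m := h hm
    have h2 : m ≤ M := hm' hM
    refine ⟨m / 2, M + 1, by linarith, by linarith, fun x hx => ⟨?_, ?_⟩⟩
    · have := hm' hx; linarith
    · have := hM' hx; linarith

lemma test_data {f : ℝ → ℂ} (hf : IsTestFun f) :
    Differentiable ℝ f ∧ Continuous (deriv f) ∧
    Differentiable ℝ (fun x : ℝ => (x:ℂ) * deriv f x) ∧
    Continuous (deriv (fun x : ℝ => (x:ℂ) * deriv f x)) ∧
    ∃ a b : ℝ, 0 < a ∧ a < b ∧ ∀ x, x ∉ Ioo a b →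
      f x = 0 ∧ deriv f x = 0 ∧ deriv (fun x : ℝ => (x:ℂ) * deriv f x) x = 0 := by
  obtain ⟨h1, h2, h3⟩ := hf
  have hd1 : ContDiff ℝ (⊤ : ℕ∞) (deriv f) := by
    have := (contDiff_infty_iff_deriv (𝕜 := ℝ) (f := f)).1 h1
    exact this.2
  have hm : ContDiff ℝ (⊤ : ℕ∞) (fun x : ℝ => (x:ℂ) * deriv f x) :=
    Complex.ofRealCLM.contDiff.mul hd1
  refine ⟨h1.differentiable (by simp), hd1.continuous, hm.differentiable (by simp),
    hm.continuous_deriv (by simp), ?_⟩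
  obtain ⟨a, b, ha, hab, hK⟩ := cpt_Ioo h2 h3
  refine ⟨a, b, ha, hab, fun x hx => ?_⟩
  have hxn : x ∉ tsupport f := fun h => hx (hK h)
  have he : f =ᶠ[nhds x] 0 := notMem_tsupport_iff_eventuallyEq.1 hxn
  have he1 : deriv f =ᶠ[nhds x] 0 := by
    have := he.deriv
    filter_upwards [this] with y hy
    rw [hy]; simp
  have he2 : (fun x : ℝ => (x:ℂ) * deriv f x) =ᶠ[nhds x] fun _ => 0 := by
    filter_upwards [he1] with y hy
    rw [hy]; simp
  refine ⟨he.eq_of_nhds, he1.eq_of_nhds, ?_⟩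
  rw [he2.deriv_eq]; simp

lemma test_memLp {f : ℝ → ℂ} (hf : IsTestFun f) : MemLp f 2 radialMeasure :=
  hf.1.continuous.memLp_of_hasCompactSupport hf.2.1

/-- potential term -/
lemma r_diffExpr (s : ℝ) (f : ℝ → ℂ) {r : ℝ} (hr : 0 < r) :
    (r:ℂ) * diffExpr s f r = - deriv (fun x : ℝ => (x : ℂ) * deriv f x) r
      + ((1 / r * (s + r^2/2)^2 : ℝ) : ℂ) * f r := by
  have : (r:ℂ) ≠ 0 := by exact_mod_cast hr.ne'
  unfold diffExpr
  push_cast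
  field_simp

lemma hasDerivAt_conj {f : ℝ → ℂ} {f' : ℂ} {x : ℝ} (h : HasDerivAt f f' x) :
    HasDerivAt (fun y => conj (f y)) (conj f') x := by
  exact (Complex.conjCLE.toContinuousLinearMap.hasFDerivAt.comp_hasDerivAt x h)

lemma form_symm (s : ℝ) {f h : ℝ → ℂ} (hf : IsTestFun f) (hh : IsTestFun h)
    (hi : IntegrableOn (fun r : ℝ => (r:ℂ) * (conj (f r) * diffExpr s h r)) (Ioi 0)) :
    ∫ r in Ioi (0:ℝ), (r:ℂ) * (conj (diffExpr s f r) * h r) =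
      ∫ r in Ioi (0:ℝ), (r:ℂ) * (conj (f r) * diffExpr s h r) := by
  obtain ⟨df, cf, dmf, cmf, a, b, ha, hab, h0⟩ := test_data hf
  obtain ⟨dh, ch, dmh, cmh, a', b', ha', hab', h0'⟩ := test_data hh
  have key := int_deriv_zero (a := a) (b := b) ha hab
    (Q := fun x => conj (f x) * (x * deriv h x) - conj (x * deriv f x) * h x)
    (Q' := fun x => conj (f x) * deriv (fun x : ℝ => (x:ℂ) * deriv h x) x
      - conj (deriv (fun x : ℝ => (x:ℂ) * deriv f x) x) * h x)
    (by
      intro x hx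
      have e1 := (hasDerivAt_conj (df x).hasDerivAt).mul (dmh x).hasDerivAt
      have e2 := (hasDerivAt_conj (dmf x).hasDerivAt).mul (dh x).hasDerivAt
      refine (e1.sub e2).congr_deriv ?_
      simp only [map_mul, Complex.conj_ofReal]
      ring)
    (by
      have := dh.continuous
      have := df.continuous
      refine Continuous.continuousOn ?_
      fun_prop)
    (by
      intro x hx
      obtain ⟨z1, z2, z3⟩ := h0 x hx
      rw [z3]
      simp [z1, z2])
  rw [← add_zero (∫ r in Ioi (0:ℝ), (r:ℂ) * (conj (f r) * diffExpr s h r)),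
    ← key.2, ← integral_add hi key.1]
  refine setIntegral_congr_fun measurableSet_Ioi fun r hr => ?_
  have e1 := r_diffExpr s f hr
  have e2 := r_diffExpr s h hr
  have e3 := congrArg conj e1
  simp only [map_add, map_mul, map_neg, Complex.conj_ofReal] at e3
  linear_combination h r * e3 - conj (f r) * e2

lemma reCLM_int {f : ℝ → ℂ} {μ : Measure ℝ} (hf : Integrable f μ) :
    (∫ x, f x ∂μ).re = ∫ x, (f x).re ∂μ := by
  have := integral_re (𝕜 := ℂ) hf
  simpa using this.symm

lemma form_pos (s : ℝ) {f : ℝ → ℂ} (hf : IsTestFun f)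
    (hi : IntegrableOn (fun r : ℝ => (r:ℂ) * (conj (diffExpr s f r) * f r)) (Ioi 0)) :
    0 ≤ (∫ r in Ioi (0:ℝ), (r:ℂ) * (conj (diffExpr s f r) * f r)).re := by
  obtain ⟨df, cf, dmf, cmf, a, b, ha, hab, h0⟩ := test_data hf
  have key := int_deriv_zero (a := a) (b := b) ha hab
    (Q := fun x => conj (x * deriv f x) * f x)
    (Q' := fun x => conj (deriv (fun x : ℝ => (x:ℂ) * deriv f x) x) * f x
       + x * (conj (deriv f x) * deriv f x))
    (by
      intro x hx
      have e2 := (hasDerivAt_conj (dmf x).hasDerivAt).mul (df x).hasDerivAt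
      refine e2.congr_deriv ?_
      simp only [map_mul, Complex.conj_ofReal]
      ring)
    (by
      have := df.continuous
      refine Continuous.continuousOn ?_
      fun_prop)
    (by
      intro x hx
      obtain ⟨z1, z2, z3⟩ := h0 x hx
      rw [z3]
      simp [z1, z2])
  rw [← add_zero (∫ r in Ioi (0:ℝ), (r:ℂ) * (conj (diffExpr s f r) * f r)),
    ← key.2, ← integral_add hi key.1]
  have hre := (reCLM_int (hi.add key.1))
  simp only [Pi.add_apply] at hre
  rw [hre]
  refine setIntegral_nonneg measurableSet_Ioi fun r hr => ?_
  have e1 := r_diffExpr s f hr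
  have e3 := congrArg conj e1
  simp only [map_add, map_mul, map_neg, Complex.conj_ofReal] at e3
  have : (r:ℂ) * (conj (diffExpr s f r) * f r) +
      (conj (deriv (fun x : ℝ => (x:ℂ) * deriv f x) r) * f r
       + r * (conj (deriv f r) * deriv f r)) =
      ((1 / r * (s + r^2/2)^2 * ‖f r‖^2 + r * ‖deriv f r‖^2 : ℝ) : ℂ) := by
    have n1 := Complex.conj_mul' (f r)
    have n2 := Complex.conj_mul' (deriv f r)
    push_cast at e3 ⊢
    linear_combination f r * e3 + (1 / (r:ℂ) * (s + (r:ℂ)^2/2)^2) * n1 + (r:ℂ) * n2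
  have hr' : (0:ℝ) < r := hr
  rw [this, Complex.ofReal_re]
  positivity

/-- real test functions -/
def IsRT (f : ℝ → ℝ) : Prop :=
  ContDiff ℝ (⊤ : ℕ∞) f ∧ HasCompactSupport f ∧ tsupport f ⊆ Set.Ioi (0 : ℝ)

lemma IsRT.zero {f : ℝ → ℝ} (hf : IsRT f) : ∃ a b : ℝ, 0 < a ∧ a < b ∧
    ∀ x, x ∉ Ioo a b → f x = 0 ∧ deriv f x = 0 := by
  obtain ⟨a, b, ha, hab, hK⟩ := cpt_Ioo hf.2.1 hf.2.2
  refine ⟨a, b, ha, hab, fun x hx => ?_⟩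
  have hxn : x ∉ tsupport f := fun h => hx (hK h)
  have he : f =ᶠ[nhds x] fun _ => 0 := notMem_tsupport_iff_eventuallyEq.1 hxn
  refine ⟨he.eq_of_nhds, ?_⟩
  rw [he.deriv_eq]; simp

lemma IsRT.of_zero {f : ℝ → ℝ} {a b : ℝ} (h1 : ContDiff ℝ (⊤ : ℕ∞) f) (ha : 0 < a)
    (h : ∀ x, x ∉ Ioo a b → f x = 0) : IsRT f := by
  have hs : tsupport f ⊆ Icc a b := by
    refine closure_minimal (fun x hx => ?_) isClosed_Icc
    by_contra hc
    exact hx (h x fun h' => hc (Ioo_subset_Icc_self h'))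
  exact ⟨h1, HasCompactSupport.of_support_subset_isCompact isCompact_Icc
    ((subset_tsupport f).trans hs), hs.trans fun x hx => lt_of_lt_of_le ha hx.1⟩

lemma IsRT.deriv' {f : ℝ → ℝ} (hf : IsRT f) : IsRT (deriv f) := by
  obtain ⟨a, b, ha, hab, h⟩ := hf.zero
  exact IsRT.of_zero ((contDiff_infty_iff_deriv (𝕜 := ℝ) (f := f)).1 hf.1).2 ha fun x hx => (h x hx).2

lemma IsRT.mul {q f : ℝ → ℝ} (hf : IsRT f) (hq : ContDiffOn ℝ (⊤ : ℕ∞) q (Ioi 0)) :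
    IsRT (fun x => q x * f x) := by
  have h1 : ContDiff ℝ (⊤ : ℕ∞) (fun x => q x * f x) := by
    rw [contDiff_iff_contDiffAt]
    intro x
    by_cases hx : x ∈ tsupport f
    · exact (hq.contDiffAt (Ioi_mem_nhds (hf.2.2 hx))).mul hf.1.contDiffAt
    · have he : f =ᶠ[nhds x] fun _ => 0 := notMem_tsupport_iff_eventuallyEq.1 hx
      have : (fun x => q x * f x) =ᶠ[nhds x] fun _ => 0 := by
        filter_upwards [he] with y hy
        rw [hy, mul_zero]
      exact (contDiffAt_const (c := (0:ℝ))).congr_of_eventuallyEq this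
  obtain ⟨a, b, ha, hab, h⟩ := hf.zero
  exact IsRT.of_zero h1 ha fun x hx => by rw [(h x hx).1, mul_zero]

lemma IsRT.lincomb {f g : ℝ → ℝ} (hf : IsRT f) (hg : IsRT g) (c : ℝ) :
    IsRT (fun x => f x - c * g x) := by
  obtain ⟨a, b, ha, hab, h⟩ := hf.zero
  obtain ⟨a', b', ha', hab', h'⟩ := hg.zero
  refine IsRT.of_zero (a := min a a') (b := max b b') ?_ (lt_min ha ha') ?_
  · exact hf.1.sub (contDiff_const.mul hg.1)
  · intro x hx
    have e1 : x ∉ Ioo a b := fun h => hx ⟨(min_le_left _ _).trans_lt h.1, h.2.trans_le (le_max_left _ _)⟩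
    have e2 : x ∉ Ioo a' b' := fun h => hx ⟨(min_le_right _ _).trans_lt h.1, h.2.trans_le (le_max_right _ _)⟩
    rw [(h x e1).1, (h' x e2).1]; simp

lemma IsRT.integrable {f : ℝ → ℝ} (hf : IsRT f) : Integrable f :=
  hf.1.continuous.integrable_of_hasCompactSupport hf.2.1

lemma IsRT.integrable_smul {f : ℝ → ℝ} (hf : IsRT f) {H : ℝ → ℂ}
    (hH : LocallyIntegrableOn H (Ioi 0)) : Integrable (fun x => f x • H x) := by
  have h1 : IntegrableOn H (tsupport f) := hH.integrableOn_compact_subset hf.2.2 hf.2.1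
  have h2 : IntegrableOn (fun x => f x • H x) (tsupport f) :=
    h1.continuousOn_smul hf.1.continuous.continuousOn hf.2.1
  rwa [integrableOn_iff_integrable_of_support_subset] at h2
  intro x hx
  by_contra hc
  apply hx
  simp [image_eq_zero_of_notMem_tsupport hc]

lemma IsRT.prim {f : ℝ → ℝ} (hf : IsRT f) (h0 : ∫ x, f x = 0) :
    ∃ g, IsRT g ∧ ∀ x, HasDerivAt g (f x) x := by
  obtain ⟨a, b, ha, hab, h⟩ := hf.zero
  have hc := hf.1.continuous
  have hd : ∀ x, HasDerivAt (fun x => ∫ t in a..x, f t) (f x) x := fun x =>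
    intervalIntegral.integral_hasDerivAt_right (hc.intervalIntegrable _ _)
      (hc.stronglyMeasurableAtFilter _ _) hc.continuousAt
  refine ⟨fun x => ∫ t in a..x, f t, IsRT.of_zero (a := a) (b := b) ?_ ha ?_, hd⟩
  · rw [contDiff_infty_iff_deriv]
    refine ⟨fun x => (hd x).differentiableAt, ?_⟩
    have : deriv (fun x => ∫ t in a..x, f t) = f := funext fun x => (hd x).deriv
    rw [this]; exact hf.1
  · intro x hx
    rcases le_or_gt x a with hxa | hxa
    · rw [intervalIntegral.integral_symm]
      rw [intervalIntegral.integral_congr (g := fun _ => (0:ℝ))]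
      · simp
      · intro t ht
        rw [uIcc_of_le hxa] at ht
        exact (h t fun h' => absurd h'.1 (not_lt.2 ht.2)).1
    · have hxb : b ≤ x := by
        by_contra hc
        exact hx ⟨hxa, not_le.1 hc⟩
      rw [intervalIntegral.integral_of_le hxa.le, setIntegral_eq_integral_of_forall_compl_eq_zero, h0]
      intro t ht
      refine (h t fun h' => ht ⟨h'.1, h'.2.le.trans hxb⟩).1

lemma exists_RT : ∃ f, IsRT f ∧ ∫ x, f x = 1 := by
  let B : ContDiffBump (2:ℝ) := ⟨1/2, 1, by norm_num, by norm_num⟩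
  refine ⟨B.normed volume, IsRT.of_zero (a := 1) (b := 3) ?_ (by norm_num) ?_, B.integral_normed⟩
  · exact B.contDiff_normed
  · intro x hx
    have : x ∉ Function.support (B.normed volume) := by
      rw [B.support_normed_eq]
      intro h
      rw [Real.ball_eq_Ioo] at h
      apply hx
      have e1 : B.rOut = 1 := rfl
      rw [e1] at h
      constructor <;> linarith [h.1, h.2]
    simpa using this

lemma dBR {H : ℝ → ℂ} (hH : LocallyIntegrableOn H (Ioi 0))
    (h : ∀ ψ, IsRT ψ → ∫ x, deriv ψ x • H x = 0) :
    ∃ c : ℂ, ∀ᵐ x : ℝ, x ∈ Ioi (0:ℝ) → H x = c := by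
  obtain ⟨φ, hφ, h1⟩ := exists_RT
  refine ⟨∫ x, φ x • H x, ?_⟩
  have hc : LocallyIntegrableOn (fun _ : ℝ => ∫ x, φ x • H x) (Ioi (0:ℝ)) :=
    (locallyIntegrable_const _).locallyIntegrableOn _
  have := isOpen_Ioi.ae_eq_zero_of_integral_contDiff_smul_eq_zero (hH.sub hc) (μ := volume) ?_
  · filter_upwards [this] with x hx hx0
    exact sub_eq_zero.1 (hx hx0)
  intro g g1 g2 g3
  have hg : IsRT g := ⟨g1, g2, g3⟩
  obtain ⟨ψ, hψ, hd⟩ := (hg.lincomb hφ (∫ x, g x)).prim (by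
    rw [integral_sub hg.integrable (hφ.integrable.const_mul _), integral_const_mul, h1]; simp)
  have e := h ψ hψ
  have hdd : ∀ x, deriv ψ x • H x = g x • H x - (∫ x, g x) • (φ x • H x) := by
    intro x
    rw [(hd x).deriv, sub_smul, mul_smul]
  simp_rw [hdd] at e
  have hi2 : Integrable (fun x => (∫ x, g x) • (φ x • H x)) := (hφ.integrable_smul hH).smul (∫ x, g x)
  rw [integral_sub (hg.integrable_smul hH) hi2, integral_smul,
    sub_eq_zero] at e
  simp only [Pi.sub_apply, smul_sub]
  rw [integral_sub (hg.integrable_smul hH) (hg.integrable_smul hc), integral_smul_const, e, sub_self]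

lemma two_dim {k v : ℝ → ℝ} (hk : ContDiffOn ℝ (⊤ : ℕ∞) k (Ioi 0)) (hpos : ∀ x > 0, 0 < k x)
    (hv : ∀ x > 0, HasDerivAt v (-k x) x) {G : ℝ → ℂ} (hG : LocallyIntegrableOn G (Ioi 0))
    (h : ∀ ψ, IsRT ψ → ∫ x, k x * ψ x = 0 → ∫ x, deriv ψ x • G x = 0) :
    ∃ a b : ℂ, ∀ᵐ x : ℝ, x ∈ Ioi (0:ℝ) → G x = a + b * v x := by
  obtain ⟨φ, hφ, h1⟩ := exists_RT
  have hki : ContDiffOn ℝ (⊤ : ℕ∞) (fun x => (k x)⁻¹) (Ioi 0) :=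
    hk.inv fun x hx => (hpos x hx).ne'
  obtain ⟨a, b, ha, hab, hz⟩ := hφ.zero
  have h1' : ∫ x, k x * ((k x)⁻¹ * φ x) = 1 := by
    rw [← h1]
    refine integral_congr_ae (Filter.Eventually.of_forall fun x => ?_)
    by_cases hx : x ∈ Ioo a b
    · have := hpos x (ha.trans hx.1)
      simp only
      field_simp
    · simp [(hz x hx).1]
  have hψ₀ := hφ.mul hki
  set ψ₀ : ℝ → ℝ := fun x => (k x)⁻¹ * φ x with hψ₀d
  set c : ℂ := ∫ x, deriv ψ₀ x • G x with hc
  have hvc : ContinuousOn v (Ioi 0) := fun x hx => (hv x hx).continuousAt.continuousWithinAt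
  have hvl : LocallyIntegrableOn (fun x => c * (v x : ℂ)) (Ioi 0) := by
    refine ContinuousOn.locallyIntegrableOn ?_ measurableSet_Ioi
    exact continuousOn_const.mul (Complex.continuous_ofReal.comp_continuousOn hvc)
  obtain ⟨a', ha'⟩ := dBR (hG.sub hvl) (by
    intro ψ hψ
    have hkψ := hψ.mul hk
    have hkψ₀ := hψ₀.mul hk
    have e := h _ (hψ.lincomb hψ₀ (∫ x, k x * ψ x)) (by
      have : ∀ x, k x * (ψ x - (∫ x, k x * ψ x) * ψ₀ x) =
        k x * ψ x - (∫ x, k x * ψ x) * (k x * ψ₀ x) := fun x => by ring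
      simp_rw [this]
      rw [integral_sub hkψ.integrable (hkψ₀.integrable.const_mul _), integral_const_mul, h1']
      simp)
    have hdd : ∀ x, deriv (fun x => ψ x - (∫ x, k x * ψ x) * ψ₀ x) x • G x
        = deriv ψ x • G x - (∫ x, k x * ψ x) • (deriv ψ₀ x • G x) := by
      intro x
      have e1 := (hψ.1.differentiable (by simp) x).hasDerivAt
      have e2 := (hψ₀.1.differentiable (by simp) x).hasDerivAt
      have e3 : HasDerivAt (fun x => ψ x - (∫ x, k x * ψ x) * ψ₀ x)
        (deriv ψ x - (∫ x, k x * ψ x) * deriv ψ₀ x) x := e1.sub (e2.const_mul _)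
      rw [e3.deriv, sub_smul, mul_smul]
    simp_rw [hdd] at e
    have hi2 : Integrable (fun x => (∫ x, k x * ψ x) • (deriv ψ₀ x • G x)) :=
      (hψ₀.deriv'.integrable_smul hG).smul (∫ x, k x * ψ x)
    rw [integral_sub (hψ.deriv'.integrable_smul hG) hi2,
      integral_smul, sub_eq_zero] at e
    simp only [Pi.sub_apply, smul_sub]
    rw [integral_sub (hψ.deriv'.integrable_smul hG) (hψ.deriv'.integrable_smul hvl), e, sub_eq_zero]
    have e3 : ∀ x, deriv ψ x • (c * (v x : ℂ)) = ((deriv ψ x * v x : ℝ) : ℂ) * c := by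
      intro x; rw [Complex.real_smul]; push_cast; ring
    simp_rw [e3]
    rw [integral_mul_const, integral_complex_ofReal, Complex.real_smul]
    congr 2
    obtain ⟨a, b, ha, hab, hz⟩ := hψ.zero
    have key := int_deriv_zero (Q := fun x => ψ x * v x)
      (Q' := fun x => deriv ψ x * v x + ψ x * (-k x)) ha hab
      (fun x hx => (hψ.1.differentiable (by simp) x).hasDerivAt.mul (hv x hx))
      ((hψ.deriv'.1.continuous.continuousOn.mul hvc).add
        (hψ.1.continuous.continuousOn.mul hk.continuousOn.neg))
      (fun x hx => by simp [hz x hx])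
    have hzz : ∀ f : ℝ → ℝ, (∀ x, x ∉ Ioo a b → f x = 0) → ∫ x, f x = ∫ x in Ioi (0:ℝ), f x := by
      intro f hf
      rw [setIntegral_eq_integral_of_forall_compl_eq_zero]
      intro x hx
      exact hf x fun h => hx (ha.trans h.1)
    rw [hzz _ (fun x hx => by simp [hz x hx]), hzz _ (fun x hx => by simp [hz x hx])]
    have hi : IntegrableOn (fun x => k x * ψ x) (Ioi 0) := hkψ.integrable.integrableOn
    have hs := integral_add hi key.1
    rw [key.2, add_zero] at hs
    rw [← hs]
    refine integral_congr_ae (Filter.Eventually.of_forall fun x => ?_)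
    simp only
    ring)
  refine ⟨a', c, ?_⟩
  filter_upwards [ha'] with x hx hx0
  have := hx hx0
  simp only [Pi.sub_apply] at this
  rw [← this]; ring

def uu (s r : ℝ) : ℝ := r ^ s * Real.exp (r ^ 2 / 4)
def kk (s r : ℝ) : ℝ := r ^ (-2 * s - 1) * Real.exp (-r ^ 2 / 2)
def vv (s r : ℝ) : ℝ := (∫ t in Ioi (1:ℝ), kk s t) - ∫ t in (1:ℝ)..r, kk s t

lemma uu_pos (s : ℝ) {r : ℝ} (hr : 0 < r) : 0 < uu s r := by
  unfold uu; positivity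

lemma kk_pos (s : ℝ) {r : ℝ} (hr : 0 < r) : 0 < kk s r := by
  unfold kk; positivity

lemma kk_eq (s : ℝ) {r : ℝ} (hr : 0 < r) : kk s r * (r * uu s r ^ 2) = 1 := by
  unfold kk uu
  have h1 : (r ^ s) ^ 2 = r ^ (2 * s) := by
    rw [mul_comm, Real.rpow_mul hr.le]; norm_num
  have h2 : Real.exp (r ^ 2 / 4) ^ 2 = Real.exp (r ^ 2 / 2) := by
    rw [← Real.exp_nat_mul]; congr 1; push_cast; ring
  have h3 : r ^ (-2 * s - 1) * (r * r ^ (2 * s)) = 1 := by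
    nth_rewrite 2 [← Real.rpow_one r]
    rw [← Real.rpow_add hr, ← Real.rpow_add hr]
    ring_nf; simp
  have h4 : Real.exp (-r ^ 2 / 2) * Real.exp (r ^ 2 / 2) = 1 := by
    rw [← Real.exp_add]; ring_nf; simp
  rw [mul_pow, h1, h2]
  calc _ = (r ^ (-2 * s - 1) * (r * r ^ (2 * s))) *
      (Real.exp (-r ^ 2 / 2) * Real.exp (r ^ 2 / 2)) := by ring
    _ = 1 := by rw [h3, h4, mul_one]

lemma uu_smooth (s : ℝ) : ContDiffOn ℝ (⊤ : ℕ∞) (uu s) (Ioi 0) := by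
  unfold uu
  refine ContDiffOn.mul (contDiffOn_id.rpow_const_of_ne fun x hx => (ne_of_gt hx)) ?_
  exact (by fun_prop : ContDiff ℝ (⊤ : ℕ∞) fun r : ℝ => Real.exp (r ^ 2 / 4)).contDiffOn

lemma kk_smooth (s : ℝ) : ContDiffOn ℝ (⊤ : ℕ∞) (kk s) (Ioi 0) := by
  unfold kk
  refine ContDiffOn.mul (contDiffOn_id.rpow_const_of_ne fun x hx => (ne_of_gt hx)) ?_
  exact (by fun_prop : ContDiff ℝ (⊤ : ℕ∞) fun r : ℝ => Real.exp (-r ^ 2 / 2)).contDiffOn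

lemma uu_deriv (s : ℝ) {r : ℝ} (hr : 0 < r) :
    HasDerivAt (uu s) ((s / r + r / 2) * uu s r) r := by
  unfold uu
  have h1 : HasDerivAt (fun r : ℝ => r ^ s) (s * r ^ (s - 1)) r :=
    Real.hasDerivAt_rpow_const (Or.inl hr.ne')
  have h2 : HasDerivAt (fun r : ℝ => Real.exp (r ^ 2 / 4))
      (Real.exp (r ^ 2 / 4) * (2 * r / 4)) r := by
    have : HasDerivAt (fun r : ℝ => r ^ 2 / 4) (2 * r / 4) r := by
      simpa using (hasDerivAt_pow 2 r).div_const 4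
    exact this.exp
  refine (h1.mul h2).congr_deriv ?_
  rw [Real.rpow_sub_one hr.ne']
  field_simp
  ring

lemma kk_int (s : ℝ) {r : ℝ} (hr : 0 < r) : IntegrableOn (kk s) (Ioi r) := by
  refine integrable_of_isBigO_exp_neg (b := 1/2) (by norm_num)
    ((kk_smooth s).continuousOn.mono fun x hx => lt_of_lt_of_le hr hx) ?_
  have h := (rpow_mul_exp_neg_mul_sq_isLittleO_exp_neg (b := 1/2) (by norm_num) (-2 * s - 1)).isBigO
  refine (h.congr' ?_ ?_)
  · refine Filter.Eventually.of_forall fun x => ?_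
    simp only [kk]; congr 2; ring
  · exact Filter.EventuallyEq.rfl

lemma kk_intervalInt (s : ℝ) {a b : ℝ} (ha : 0 < a) (hb : 0 < b) :
    IntervalIntegrable (kk s) volume a b := by
  refine ((kk_smooth s).continuousOn.mono ?_).intervalIntegrable
  intro x hx
  exact lt_of_lt_of_le (lt_min ha hb) hx.1

lemma vv_deriv (s : ℝ) {r : ℝ} (hr : 0 < r) : HasDerivAt (vv s) (-kk s r) r := by
  have h : HasDerivAt (fun r => ∫ t in (1:ℝ)..r, kk s t) (kk s r) r := by
    refine intervalIntegral.integral_hasDerivAt_right (kk_intervalInt s one_pos hr) ?_ ?_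
    · exact (kk_smooth s).continuousOn.stronglyMeasurableAtFilter isOpen_Ioi r hr
    · exact (kk_smooth s).continuousOn.continuousAt (Ioi_mem_nhds hr)
  exact h.const_sub _

lemma vv_eq (s : ℝ) {r : ℝ} (hr : 0 < r) : vv s r = ∫ t in Ioi r, kk s t := by
  have := intervalIntegral.integral_interval_add_Ioi (kk_int s one_pos) (kk_int s hr)
  unfold vv
  rw [← this]; ring

lemma vv_tendsto (s : ℝ) : Filter.Tendsto (vv s) Filter.atTop (nhds 0) := by
  have := intervalIntegral_tendsto_integral_Ioi (1:ℝ) (kk_int s one_pos) Filter.tendsto_id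
  have h2 := this.const_sub (∫ t in Ioi (1:ℝ), kk s t)
  rw [sub_self] at h2
  exact h2

lemma vv_pos (s : ℝ) {r : ℝ} (hr : 0 < r) : 0 < vv s r := by
  rw [vv_eq s hr]
  rw [setIntegral_pos_iff_support_of_nonneg_ae]
  · have : Function.support (kk s) ∩ Ioi r = Ioi r := by
      refine inter_eq_right.2 fun x hx => ?_
      exact (kk_pos s (hr.trans hx)).ne'
    rw [this]; simp
  · filter_upwards [ae_restrict_mem measurableSet_Ioi] with x hx
    exact (kk_pos s (hr.trans hx)).le
  · exact kk_int s hr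

/-- construct test function -/
lemma exists_test (s : ℝ) {ψ : ℝ → ℝ} (hψ : IsRT ψ) (h0 : ∫ x, kk s x * ψ x = 0) :
    ∃ f, IsTestFun f ∧ ∀ r : ℝ, 0 < r → (r:ℂ) * (diffExpr s f r + f r) = ((-(deriv ψ r / uu s r) : ℝ) : ℂ) := by
  obtain ⟨F, hF, hd⟩ := (hψ.mul (kk_smooth s)).prim h0
  have hR := hF.mul (uu_smooth s)
  refine ⟨fun x => ((uu s x * F x : ℝ) : ℂ), ⟨?_, ?_, ?_⟩, ?_⟩
  · exact Complex.ofRealCLM.contDiff.comp hR.1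
  · exact hR.2.1.comp_left (g := fun x : ℝ => (x : ℂ)) (by simp)
  · refine subset_trans ?_ hR.2.2
    exact tsupport_comp_subset (g := fun x : ℝ => (x : ℂ)) (by simp) _
  intro r hr
  have hf' : ∀ x > 0, deriv (fun x => ((uu s x * F x : ℝ) : ℂ)) x =
      (((s / x + x / 2) * uu s x * F x + uu s x * (kk s x * ψ x) : ℝ) : ℂ) := by
    intro x hx
    exact (((uu_deriv s hx).mul (hd x)).ofReal_comp).deriv
  have he : (fun x : ℝ => (x:ℂ) * deriv (fun x => ((uu s x * F x : ℝ) : ℂ)) x) =ᶠ[nhds r]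
      fun x => (((s + x ^ 2 / 2) * (uu s x * F x) + ψ x * (uu s x)⁻¹ : ℝ) : ℂ) := by
    filter_upwards [Ioi_mem_nhds hr] with x hx
    have hx' : (0:ℝ) < x := hx
    have h1 := kk_eq s hx'
    have h2 := uu_pos s hx'
    rw [hf' x hx, ← Complex.ofReal_mul]
    congr 1
    have h3 : kk s x = (x * uu s x ^ 2)⁻¹ := eq_inv_of_mul_eq_one_left h1
    rw [h3]
    field_simp
    try ring
  have hu := uu_pos s hr
  have hder : HasDerivAt (fun x => (s + x ^ 2 / 2) * (uu s x * F x) + ψ x * (uu s x)⁻¹)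
      (r * (uu s r * F r) + (s + r ^ 2 / 2) * ((s / r + r / 2) * uu s r * F r + uu s r * (kk s r * ψ r))
        + (deriv ψ r * (uu s r)⁻¹ + ψ r * (-((s / r + r / 2) * uu s r) / uu s r ^ 2))) r := by
    have e1 : HasDerivAt (fun x : ℝ => s + x ^ 2 / 2) r r := by
      have := ((hasDerivAt_pow 2 r).div_const 2).const_add s
      refine this.congr_deriv ?_
      simp
    have e2 := (uu_deriv s hr).mul (hd r)
    have e3 := (hψ.1.differentiable (by simp) r).hasDerivAt
    have e4 := (uu_deriv s hr).inv hu.ne'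
    exact (e1.mul e2).add (e3.mul e4)
  have hder' := hder.ofReal_comp
  rw [mul_add, r_diffExpr s _ hr, he.deriv_eq]
  rw [hder'.deriv]
  have h3 : kk s r = (r * uu s r ^ 2)⁻¹ := eq_inv_of_mul_eq_one_left (kk_eq s hr)
  rw [h3]
  beta_reduce
  simp only [← Complex.ofReal_mul, ← Complex.ofReal_add, ← Complex.ofReal_neg]
  congr 1
  field_simp
  ring

lemma w_orth (s : ℝ) {f : ℝ → ℂ} (hf : IsTestFun f) :
    ∫ r in Ioi (0:ℝ), ((uu s r * vv s r : ℝ) : ℂ) * ((r:ℂ) * (diffExpr s f r + f r)) = 0 := by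
  obtain ⟨df, cf, dmf, cmf, a, b, ha, hab, h0⟩ := test_data hf
  have hwd : ∀ r > 0, HasDerivAt (fun r => uu s r * vv s r)
      ((s / r + r / 2) * uu s r * vv s r + uu s r * (-kk s r)) r := fun r hr =>
    (uu_deriv s hr).mul (vv_deriv s hr)
  have hud : ∀ r > 0, HasDerivAt (fun r => (uu s r)⁻¹)
      (-((s / r + r / 2) * uu s r) / uu s r ^ 2) r := fun r hr =>
    (uu_deriv s hr).inv (uu_pos s hr).ne'
  have hcw : ContinuousOn (fun r => uu s r * vv s r) (Ioi 0) := fun r hr =>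
    (hwd r hr).continuousAt.continuousWithinAt
  have key := int_deriv_zero (a := a) (b := b) ha hab
    (Q := fun r => (((s + r ^ 2 / 2) * (uu s r * vv s r) - (uu s r)⁻¹ : ℝ) : ℂ) * f r
      - ((uu s r * vv s r : ℝ) : ℂ) * ((r:ℂ) * deriv f r))
    (Q' := fun r => ((uu s r * vv s r : ℝ) : ℂ) *
      (-deriv (fun x : ℝ => (x : ℂ) * deriv f x) r
      + ((1 / r * (s + r^2/2)^2 : ℝ) : ℂ) * f r + (r:ℂ) * f r))
    (by
      intro r hr
      have e1 : HasDerivAt (fun x : ℝ => s + x ^ 2 / 2) r r := by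
        have := ((hasDerivAt_pow 2 r).div_const 2).const_add s
        refine this.congr_deriv ?_
        simp
      have e2 := (((e1.mul (hwd r hr)).sub (hud r hr)).ofReal_comp).mul (df r).hasDerivAt
      have e3 := (hwd r hr).ofReal_comp.mul (dmf r).hasDerivAt
      refine (e2.sub e3).congr_deriv ?_
      have h3 : kk s r = (r * uu s r ^ 2)⁻¹ := eq_inv_of_mul_eq_one_left (kk_eq s hr)
      have hu : (uu s r : ℂ) ≠ 0 := by exact_mod_cast (uu_pos s hr).ne'
      have hrc : (r : ℂ) ≠ 0 := by exact_mod_cast hr.ne'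
      simp only [h3, Pi.mul_apply, Pi.sub_apply]
      push_cast
      field_simp
      ring)
    (by
      have := df.continuous
      refine ContinuousOn.mul (Complex.continuous_ofReal.comp_continuousOn hcw) ?_
      refine ContinuousOn.add (ContinuousOn.add (by fun_prop) (ContinuousOn.mul ?_ (by fun_prop)))
        (by fun_prop)
      refine Complex.continuous_ofReal.comp_continuousOn ?_
      refine ContinuousOn.mul ?_ (by fun_prop)
      exact continuousOn_const.div continuousOn_id fun x hx => ne_of_gt hx)
    (by
      intro x hx
      obtain ⟨z1, z2, z3⟩ := h0 x hx
      rw [z3]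
      simp [z1, z2])
  rw [← key.2]
  refine setIntegral_congr_fun measurableSet_Ioi fun r hr => ?_
  rw [mul_add, r_diffExpr s f hr]

lemma integrable_rad_real {f : ℝ → ℝ} :
    Integrable f radialMeasure ↔ IntegrableOn (fun r : ℝ => r * f r) (Ioi (0:ℝ)) := by
  unfold radialMeasure
  rw [integrable_withDensity_iff_integrable_smul' (by fun_prop) (by simp)]
  refine integrable_congr ?_
  filter_upwards [ae_restrict_mem measurableSet_Ioi] with r hr
  simp [ENNReal.toReal_ofReal (le_of_lt hr)]

lemma kk_tendsto (s : ℝ) : Filter.Tendsto (kk s) Filter.atTop (nhds 0) := by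
  have h := (rpow_mul_exp_neg_mul_sq_isLittleO_exp_neg (b := 1/2) (by norm_num) (-2 * s - 1)).isBigO
  have h2 : Filter.Tendsto (fun x : ℝ => Real.exp (-(1/2) * x)) Filter.atTop (nhds 0) := by
    refine Real.tendsto_exp_atBot.comp ?_
    exact Filter.tendsto_id.const_mul_atTop_of_neg (by norm_num)
  refine (h.trans_tendsto h2).congr fun x => ?_
  simp only [kk]; congr 2; ring

lemma vv_neg_one {r : ℝ} (hr : 0 < r) : vv (-1) r = Real.exp (-r ^ 2 / 2) := by
  have hk : ∀ x : ℝ, kk (-1) x = x * Real.exp (-x ^ 2 / 2) := by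
    intro x; unfold kk; norm_num
  rw [vv_eq _ hr]
  have hd : ∀ x ∈ Ici r, HasDerivAt (fun x : ℝ => -Real.exp (-x ^ 2 / 2)) (kk (-1) x) x := by
    intro x _
    have : HasDerivAt (fun r : ℝ => -r ^ 2 / 2) (-x) x := by
      refine ((hasDerivAt_pow 2 x).neg.div_const 2).congr_deriv ?_
      simp; ring
    refine this.exp.neg.congr_deriv ?_
    rw [hk]; ring
  have ht : Filter.Tendsto (fun x : ℝ => -Real.exp (-x ^ 2 / 2)) Filter.atTop (nhds 0) := by
    have := (kk_tendsto (-1/2)).neg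
    rw [neg_zero] at this
    refine this.congr fun x => ?_
    have e : (-2 * (-1/2:ℝ) - 1) = 0 := by norm_num
    unfold kk
    rw [e]; simp
  rw [integral_Ioi_of_hasDerivAt_of_tendsto' hd (kk_int _ hr) ht]
  simp

lemma vv_le_kk {s : ℝ} (hs : -1 ≤ s) {r : ℝ} (hr : 0 < r) : vv s r ≤ kk s r / r := by
  have h1 : vv s r ≤ ∫ t in Ioi r, r ^ (-2 * s - 2) * kk (-1) t := by
    rw [vv_eq s hr]
    refine setIntegral_mono_on (kk_int s hr) ((kk_int _ hr).const_mul _) measurableSet_Ioi ?_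
    intro t ht
    have ht' : r < t := ht
    have ht0 : 0 < t := hr.trans ht'
    have e1 : t ^ (-2 * s - 1) = t ^ (-2 * s - 2) * t := by
      nth_rewrite 3 [← Real.rpow_one t]
      rw [← Real.rpow_add ht0]; congr 1; ring
    have e2 : t ^ (-2 * s - 2) ≤ r ^ (-2 * s - 2) :=
      Real.rpow_le_rpow_of_nonpos hr ht'.le (by linarith)
    unfold kk
    rw [e1, mul_assoc]
    refine mul_le_mul e2 (le_of_eq ?_) (by positivity) (by positivity)
    norm_num
  rw [integral_const_mul, ← vv_eq _ hr, vv_neg_one hr] at h1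
  refine h1.trans (le_of_eq ?_)
  unfold kk
  have e1 : r ^ (-2 * s - 1) = r ^ (-2 * s - 2) * r := by
    nth_rewrite 3 [← Real.rpow_one r]
    rw [← Real.rpow_add hr]; congr 1; ring
  rw [e1]; field_simp

lemma vv_anti (s : ℝ) {r : ℝ} (hr : 0 < r) (hr1 : r ≤ 1) : vv s 1 ≤ vv s r := by
  have : 0 ≤ ∫ t in r..1, kk s t := by
    refine intervalIntegral.integral_nonneg hr1 fun t ht => (kk_pos s (hr.trans_le ht.1)).le
  unfold vv
  rw [intervalIntegral.integral_same, intervalIntegral.integral_symm]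
  linarith

lemma vv_upper {s β : ℝ} (hβ : 0 < β) (hβs : 2 * s ≤ β + s - s + 0 ∨ 2 * s ≤ β)
    {r : ℝ} (hr : 0 < r) (hr1 : r ≤ 1) :
    vv s r ≤ (vv s 1 + β⁻¹) * r ^ (-β) := by
  have hβs' : 2 * s ≤ β := by rcases hβs with h | h <;> linarith
  have h1 : vv s r = vv s 1 + ∫ t in r..1, kk s t := by
    unfold vv
    rw [intervalIntegral.integral_same, intervalIntegral.integral_symm]
    ring
  have hz : (0:ℝ) ∉ uIcc r 1 := by
    rw [uIcc_of_le hr1]; intro h; exact absurd h.1 (not_le.2 hr)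
  have h2 : ∫ t in r..1, kk s t ≤ ∫ t in r..1, t ^ (-β - 1) := by
    refine intervalIntegral.integral_mono_on hr1 (kk_intervalInt s hr one_pos)
      (intervalIntegral.intervalIntegrable_rpow (Or.inr hz)) ?_
    intro t ht
    have ht0 : 0 < t := hr.trans_le ht.1
    unfold kk
    have e1 : t ^ (-2 * s - 1) ≤ t ^ (-β - 1) :=
      Real.rpow_le_rpow_of_exponent_ge ht0 ht.2 (by linarith)
    have e2 : Real.exp (-t ^ 2 / 2) ≤ 1 := Real.exp_le_one_iff.2 (by nlinarith [sq_nonneg t])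
    calc _ ≤ t ^ (-β - 1) * 1 := mul_le_mul e1 e2 (by positivity) (by positivity)
      _ = _ := mul_one _
  rw [integral_rpow (Or.inr ⟨by linarith, hz⟩)] at h2
  have h3 : (1 ^ (-β - 1 + 1) - r ^ (-β - 1 + 1)) / (-β - 1 + 1) ≤ β⁻¹ * r ^ (-β) := by
    rw [Real.one_rpow]
    have : -β - 1 + 1 = -β := by ring
    rw [this]
    have : (1 - r ^ (-β)) / (-β) = β⁻¹ * r ^ (-β) - β⁻¹ := by field_simp; ring
    rw [this]
    have : 0 < β⁻¹ := inv_pos.2 hβ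
    linarith
  have h4 : 1 ≤ r ^ (-β) := Real.one_le_rpow_of_pos_of_le_one_of_nonpos hr hr1 (by linarith)
  have h5 := vv_pos s one_pos
  rw [h1]
  nlinarith

lemma w_cont (s : ℝ) : ContinuousOn (fun r => uu s r * vv s r) (Ioi 0) := fun r hr =>
    ((uu_deriv s hr).mul (vv_deriv s hr)).continuousAt.continuousWithinAt

lemma uu_sq (s : ℝ) {r : ℝ} (hr : 0 < r) : uu s r ^ 2 = r ^ (2 * s) * Real.exp (r ^ 2 / 2) := by
  unfold uu
  have h1 : (r ^ s) ^ 2 = r ^ (2 * s) := by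
    rw [mul_comm, Real.rpow_mul hr.le]; norm_num
  have h2 : Real.exp (r ^ 2 / 4) ^ 2 = Real.exp (r ^ 2 / 2) := by
    rw [← Real.exp_nat_mul]; congr 1; push_cast; ring
  rw [mul_pow, h1, h2]

lemma w_int {s : ℝ} (hs : |s| < 1) :
    IntegrableOn (fun r => r * (uu s r * vv s r) ^ 2) (Ioi 0) := by
  have hc : ContinuousOn (fun r => r * (uu s r * vv s r) ^ 2) (Ioi 0) :=
    continuousOn_id.mul ((w_cont s).pow 2)
  have hab := abs_lt.1 hs
  rw [← Ioc_union_Ioi_eq_Ioi zero_le_one]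
  refine IntegrableOn.union ?_ ?_
  · have hα1 : |s| ≤ (1 + |s|) / 2 := by linarith
    set α := (1 + |s|) / 2 with hα
    have hα2 : α < 1 := by rw [hα]; linarith
    have hle := le_abs_self s
    have hle' := neg_abs_le s
    have hα3 : |s| < α := by rw [hα]; linarith
    have hβ : 0 < s + α := by linarith
    have hi : IntegrableOn (fun r : ℝ => Real.exp (1/2) * (vv s 1 + (s + α)⁻¹) ^ 2 * r ^ (1 - 2 * α))
        (Ioc 0 1) := by
      refine Integrable.const_mul ?_ _
      have := intervalIntegral.intervalIntegrable_rpow' (a := 0) (b := 1) (r := 1 - 2 * α) (by linarith)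
      rwa [intervalIntegrable_iff_integrableOn_Ioc_of_le zero_le_one] at this
    refine Integrable.mono' hi ((hc.mono Ioc_subset_Ioi_self).aestronglyMeasurable measurableSet_Ioc) ?_
    filter_upwards [ae_restrict_mem measurableSet_Ioc] with r hr
    have hr0 := hr.1
    have hv := vv_upper (s := s) hβ (Or.inr (by linarith)) hr.1 hr.2
    have hvp := vv_pos s hr.1
    have hv2 : vv s r ^ 2 ≤ (vv s 1 + (s + α)⁻¹) ^ 2 * r ^ (-2 * (s + α)) := by
      have : r ^ (-2 * (s + α)) = (r ^ (-(s+α))) ^ 2 := by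
        rw [← Real.rpow_natCast, ← Real.rpow_mul hr0.le]; congr 1; push_cast; ring
      rw [this, ← mul_pow]
      exact pow_le_pow_left₀ hvp.le hv 2
    have hexp : Real.exp (r ^ 2 / 2) ≤ Real.exp (1 / 2) := by
      apply Real.exp_le_exp.2
      nlinarith [hr.1, hr.2]
    rw [Real.norm_of_nonneg (by positivity), mul_pow, uu_sq s hr0]
    have e : r ^ (1 - 2 * α) = r * r ^ (2 * s) * r ^ (-2 * (s + α)) := by
      nth_rewrite 2 [← Real.rpow_one r]
      rw [← Real.rpow_add hr0, ← Real.rpow_add hr0]; congr 1; ring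
    rw [e]
    calc r * (r ^ (2 * s) * Real.exp (r ^ 2 / 2) * vv s r ^ 2)
        = (r * r ^ (2 * s)) * (Real.exp (r ^ 2 / 2) * vv s r ^ 2) := by ring
      _ ≤ (r * r ^ (2 * s)) * (Real.exp (1 / 2) *
          ((vv s 1 + (s + α)⁻¹) ^ 2 * r ^ (-2 * (s + α)))) := by gcongr
      _ = _ := by ring
  · refine Integrable.mono' (kk_int s one_pos)
      ((hc.mono (Ioi_subset_Ioi zero_le_one)).aestronglyMeasurable measurableSet_Ioi) ?_
    filter_upwards [ae_restrict_mem measurableSet_Ioi] with r hr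
    have hr1 : 1 < r := hr
    have hr0 : 0 < r := one_pos.trans hr1
    have hv := vv_le_kk (s := s) (by linarith) hr0
    have hvp := vv_pos s hr0
    have hkp := kk_pos s hr0
    have hk := kk_eq s hr0
    have hv' : vv s r ≤ kk s r := hv.trans (div_le_self hkp.le hr1.le)
    have hup := uu_pos s hr0
    rw [Real.norm_of_nonneg (by positivity)]
    calc r * (uu s r * vv s r) ^ 2 = (r * uu s r ^ 2) * vv s r ^ 2 := by ring
      _ ≤ (r * uu s r ^ 2) * kk s r ^ 2 := by gcongr
      _ = (kk s r * (r * uu s r ^ 2)) * kk s r := by ring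
      _ = kk s r := by rw [hk, one_mul]

lemma w_lower {s : ℝ} (hs : 1 ≤ |s|) :
    ∃ c > 0, ∀ r ∈ Ioo (0:ℝ) 1, c * r⁻¹ ≤ uu s r * vv s r := by
  have hu : ∀ r ∈ Ioo (0:ℝ) 1, r ^ s ≤ uu s r := by
    intro r hr
    unfold uu
    have : 1 ≤ Real.exp (r ^ 2 / 4) := Real.one_le_exp (by positivity)
    have h2 : 0 < r ^ s := Real.rpow_pos_of_pos hr.1 s
    nlinarith
  rcases le_abs'.1 hs with h | h
  · refine ⟨vv s 1, vv_pos s one_pos, fun r hr => ?_⟩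
    have h1 : r⁻¹ ≤ r ^ s := by
      rw [← Real.rpow_neg_one]
      exact Real.rpow_le_rpow_of_exponent_ge hr.1 hr.2.le h
    have h2 := vv_anti s hr.1 hr.2.le
    rw [mul_comm]
    refine mul_le_mul (h1.trans (hu r hr)) h2 (vv_pos s one_pos).le (uu_pos s hr.1).le
  · refine ⟨2 ^ (-2 * s - 1) * Real.exp (-2), by positivity, fun r hr => ?_⟩
    have hr0 := hr.1
    have hr2 : r ≤ 2 * r := by linarith
    have h1 : r * ((2 * r) ^ (-2 * s - 1) * Real.exp (-2)) ≤ vv s r := by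
      rw [vv_eq s hr0]
      have e1 : ∫ t in Ioc r (2 * r), (2 * r) ^ (-2 * s - 1) * Real.exp (-2) ≤
          ∫ t in Ioc r (2 * r), kk s t := by
        refine setIntegral_mono_on
          (continuousOn_const.integrableOn_Icc.mono_set Ioc_subset_Icc_self) ((kk_int s hr0).mono_set Ioc_subset_Ioi_self)
          measurableSet_Ioc ?_
        intro t ht
        have ht0 : 0 < t := hr0.trans ht.1
        unfold kk
        refine mul_le_mul (Real.rpow_le_rpow_of_nonpos ht0 ht.2 (by linarith)) ?_ (by positivity)
          (by positivity)
        apply Real.exp_le_exp.2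
        nlinarith [ht.2, hr.2]
      have e2 : ∫ t in Ioc r (2 * r), kk s t ≤ ∫ t in Ioi r, kk s t := by
        refine setIntegral_mono_set (kk_int s hr0) ?_ (Filter.Eventually.of_forall fun x hx => hx.1)
        filter_upwards [ae_restrict_mem measurableSet_Ioi] with x hx
        exact (kk_pos s (hr0.trans hx)).le
      refine le_trans (le_of_eq ?_) (e1.trans e2)
      rw [setIntegral_const]
      simp [measureReal_def, two_mul, hr0.le]
    have h3 : r⁻¹ ≤ r ^ (-s) := by
      rw [← Real.rpow_neg_one]
      exact Real.rpow_le_rpow_of_exponent_ge hr.1 hr.2.le (by linarith)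
    have h4 : r ^ s * (r * ((2 * r) ^ (-2 * s - 1) * Real.exp (-2))) =
        2 ^ (-2 * s - 1) * Real.exp (-2) * r ^ (-s) := by
      rw [Real.mul_rpow (by norm_num) hr0.le]
      have : r ^ (-s) = r ^ s * r * r ^ (-2 * s - 1) := by
        nth_rewrite 3 [← Real.rpow_one r]
        rw [← Real.rpow_add hr0, ← Real.rpow_add hr0]; congr 1; ring
      rw [this]; ring
    calc _ ≤ 2 ^ (-2 * s - 1) * Real.exp (-2) * r ^ (-s) := by gcongr
      _ = _ := h4.symm
      _ ≤ _ := mul_le_mul (hu r hr) h1 (by positivity) (uu_pos s hr0).le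

lemma w_not_int {s : ℝ} (hs : 1 ≤ |s|) :
    ¬ IntegrableOn (fun r => r * (uu s r * vv s r) ^ 2) (Ioi 0) := by
  intro hi
  obtain ⟨c, hc, h⟩ := w_lower hs
  have hi2 := hi.mono_set (Ioo_subset_Ioi_self : Ioo (0:ℝ) 1 ⊆ Ioi 0)
  have h3 : IntegrableOn (fun r : ℝ => c ^ 2 * r ^ (-1 : ℝ)) (Ioo 0 1) := by
    refine Integrable.mono' hi2 ?_ ?_
    · refine ContinuousOn.aestronglyMeasurable ?_ measurableSet_Ioo
      exact continuousOn_const.mul (continuousOn_id.rpow_const fun x hx => Or.inl (ne_of_gt hx.1))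
    · filter_upwards [ae_restrict_mem measurableSet_Ioo] with r hr
      have hr0 := hr.1
      rw [Real.norm_of_nonneg (by positivity), Real.rpow_neg_one]
      have : (c * r⁻¹) ^ 2 ≤ (uu s r * vv s r) ^ 2 := pow_le_pow_left₀ (by positivity) (h r hr) 2
      calc c ^ 2 * r⁻¹ = r * (c * r⁻¹) ^ 2 := by field_simp
        _ ≤ _ := by gcongr
  have h4 : IntegrableOn (fun r : ℝ => r ^ (-1 : ℝ)) (Ioo 0 1) := by
    have := h3.const_mul (c ^ 2)⁻¹
    refine this.congr (Filter.Eventually.of_forall fun r => ?_)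
    simp only
    field_simp
  rw [intervalIntegral.integrableOn_Ioo_rpow_iff one_pos] at h4
  exact lt_irrefl _ h4

lemma coef_zero {s : ℝ} {a b : ℂ}
    (hi : IntegrableOn (fun r => r * ‖(uu s r : ℂ) * (a + b * vv s r)‖ ^ 2) (Ioi 0)) : a = 0 := by
  by_contra ha
  have hap : 0 < ‖a‖ := norm_pos_iff.2 ha
  have h1 : ∀ᶠ r in Filter.atTop, ‖a‖ / 2 ≤ ‖a + b * vv s r‖ := by
    have : Filter.Tendsto (fun r => ‖a + b * (vv s r : ℂ)‖) Filter.atTop (nhds ‖a + b * ((0:ℝ):ℂ)‖) :=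
      ((((Complex.continuous_ofReal.tendsto 0).comp (vv_tendsto s)).const_mul b).const_add a).norm
    simp only [Complex.ofReal_zero, mul_zero, add_zero] at this
    exact this.eventually_const_le (by linarith)
  have h2 : ∀ᶠ r in Filter.atTop, kk s r ≤ 1 := (kk_tendsto s).eventually_le_const one_pos
  obtain ⟨R, hR⟩ := Filter.eventually_atTop.1 (h1.and (h2.and (Filter.eventually_gt_atTop (0:ℝ))))
  have hR0 : 0 < R := (hR R le_rfl).2.2
  have hi2 := hi.mono_set (Ioi_subset_Ioi hR0.le)
  have h3 : IntegrableOn (fun _ : ℝ => (‖a‖ / 2) ^ 2) (Ioi R) := by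
    refine Integrable.mono' hi2 aestronglyMeasurable_const ?_
    filter_upwards [ae_restrict_mem measurableSet_Ioi] with r hr
    obtain ⟨e1, e2, e3⟩ := hR r (le_of_lt hr)
    have hk := kk_eq s e3
    have hu := uu_pos s e3
    have hkp := kk_pos s e3
    have e4 : 1 ≤ r * uu s r ^ 2 := by
      have : 0 < r * uu s r ^ 2 := by positivity
      nlinarith
    rw [Real.norm_of_nonneg (by positivity), norm_mul, mul_pow, Complex.norm_real,
      Real.norm_of_nonneg hu.le, ← mul_assoc]
    have e5 : (‖a‖ / 2) ^ 2 ≤ ‖a + b * vv s r‖ ^ 2 := pow_le_pow_left₀ (by positivity) e1 2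
    nlinarith [sq_nonneg ‖a + b * vv s r‖]
  rw [integrableOn_const_iff] at h3
  simp [ha] at h3

lemma loc_int (g : Lp ℂ 2 radialMeasure) :
    LocallyIntegrableOn (fun r : ℝ => (r:ℂ) * conj (g r)) (Ioi 0) := by
  rw [locallyIntegrableOn_iff isOpen_Ioi.isLocallyClosed]
  intro K hK hKc
  have h1 : LocallyIntegrable g radialMeasure :=
    (Lp.memLp g).locallyIntegrable (by norm_num)
  have h2 : IntegrableOn g K radialMeasure := h1.integrableOn_isCompact hKc
  rw [← integrable_indicator_iff hKc.measurableSet, integrable_rad] at h2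
  have h3 := h2.mono_set hK
  have h4 : IntegrableOn (fun r : ℝ => conj ((r:ℂ) * (K.indicator g r))) K :=
    (ContinuousLinearMap.integrable_comp (Complex.conjCLE : ℂ →L[ℝ] ℂ) h3)
  refine h4.congr_fun (fun r hr => ?_) hKc.measurableSet
  simp [indicator_of_mem hr]

lemma loc_int_G (s : ℝ) (g : Lp ℂ 2 radialMeasure) :
    LocallyIntegrableOn (fun r : ℝ => conj (g r) / (uu s r : ℂ)) (Ioi 0) := by
  have h1 := loc_int g
  rw [locallyIntegrableOn_iff isOpen_Ioi.isLocallyClosed] at h1 ⊢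
  intro K hK hKc
  have hc : ContinuousOn (fun r : ℝ => (((r * uu s r)⁻¹ : ℝ) : ℂ)) K := by
    refine Complex.continuous_ofReal.comp_continuousOn ?_
    refine ContinuousOn.inv₀ (continuousOn_id.mul ((uu_smooth s).continuousOn.mono hK)) ?_
    intro x hx
    exact (mul_pos (hK hx) (uu_pos s (hK hx))).ne'
  refine ((h1 K hK hKc).continuousOn_mul hc hKc).congr_fun (fun r hr => ?_) hKc.measurableSet
  have hr0 : (r:ℂ) ≠ 0 := Complex.ofReal_ne_zero.2 (ne_of_gt (hK hr))
  have hu0 : (uu s r:ℂ) ≠ 0 := Complex.ofReal_ne_zero.2 (uu_pos s (hK hr)).ne'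
  simp only [Complex.ofReal_inv, Complex.ofReal_mul]
  field_simp

lemma IsRT.test {φ : ℝ → ℝ} (h : IsRT φ) : IsTestFun (fun r => (φ r : ℂ)) :=
  ⟨Complex.ofRealCLM.contDiff.comp h.1, h.2.1.comp_left (g := fun x : ℝ => (x:ℂ)) (by simp),
    (tsupport_comp_subset (g := fun x : ℝ => (x:ℂ)) (by simp) φ).trans h.2.2⟩

section main

variable {s : ℝ} {T : Lp ℂ 2 radialMeasure →ₗ.[ℂ] Lp ℂ 2 radialMeasure}

lemma dom_of_test
    (hdom : ∀ F : Lp ℂ 2 radialMeasure,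
      F ∈ T.domain ↔ ∃ f : ℝ → ℂ, IsTestFun f ∧ ⇑F =ᵐ[radialMeasure] f)
    {f : ℝ → ℂ} (hf : IsTestFun f) :
    ∃ F : T.domain, ⇑(F : Lp ℂ 2 radialMeasure) =ᵐ[radialMeasure] f :=
  ⟨⟨(test_memLp hf).toLp f, (hdom _).2 ⟨f, hf, (test_memLp hf).coeFn_toLp⟩⟩,
    (test_memLp hf).coeFn_toLp⟩

lemma dom_dense
    (hdom : ∀ F : Lp ℂ 2 radialMeasure,
      F ∈ T.domain ↔ ∃ f : ℝ → ℂ, IsTestFun f ∧ ⇑F =ᵐ[radialMeasure] f) :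
    Dense (T.domain : Set (Lp ℂ 2 radialMeasure)) := by
  rw [Submodule.dense_iff_topologicalClosure_eq_top, Submodule.topologicalClosure_eq_top_iff,
    Submodule.eq_bot_iff]
  intro g hg
  rw [Submodule.mem_orthogonal'] at hg
  have h1 : ∀ᵐ x : ℝ, x ∈ Ioi (0:ℝ) → (x:ℂ) * conj (g x) = 0 := by
    refine isOpen_Ioi.ae_eq_zero_of_integral_contDiff_smul_eq_zero (loc_int g) ?_
    intro φ h1 h2 h3
    have hφ : IsRT φ := ⟨h1, h2, h3⟩
    obtain ⟨F, hF⟩ := dom_of_test hdom hφ.test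
    have h4 := hg F F.2
    rw [inner_rad] at h4
    rw [← h4, ← setIntegral_eq_integral_of_forall_compl_eq_zero (s := Ioi (0:ℝ))]
    · refine integral_congr_ae ?_
      filter_upwards [ae_Ioi_of_rad hF] with x hx
      rw [hx]
      simp only [Complex.real_smul]
      ring
    · intro x hx
      have : φ x = 0 := image_eq_zero_of_notMem_tsupport fun h => hx (h3 h)
      rw [this, zero_smul]
  rw [Lp.eq_zero_iff_ae_eq_zero]
  refine ae_rad_iff.2 ?_
  filter_upwards [h1] with x hx h0
  have := hx h0
  have hx0 : (x:ℂ) ≠ 0 := Complex.ofReal_ne_zero.2 h0.ne'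
  simpa [hx0, h0.ne'] using this

lemma T_symm
    (hdom : ∀ F : Lp ℂ 2 radialMeasure,
      F ∈ T.domain ↔ ∃ f : ℝ → ℂ, IsTestFun f ∧ ⇑F =ᵐ[radialMeasure] f)
    (haction : ∀ (F : T.domain) (f : ℝ → ℂ), IsTestFun f →
      ⇑(F : Lp ℂ 2 radialMeasure) =ᵐ[radialMeasure] f →
      ⇑(T F) =ᵐ[radialMeasure] diffExpr s f) (x y : T.domain) :
      ⟪T x, (y : Lp ℂ 2 radialMeasure)⟫ = ⟪(x : Lp ℂ 2 radialMeasure), T y⟫ := by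
  obtain ⟨f, hf, hxf⟩ := (hdom x).1 x.2
  obtain ⟨h, hh, hyh⟩ := (hdom y).1 y.2
  have hTx := ae_Ioi_of_rad (haction x f hf hxf)
  have hTy := ae_Ioi_of_rad (haction y h hh hyh)
  have hx := ae_Ioi_of_rad hxf
  have hy := ae_Ioi_of_rad hyh
  have e2 : (fun r : ℝ => (r:ℂ) * (conj ((x : Lp ℂ 2 radialMeasure) r) * (T y) r))
      =ᵐ[volume.restrict (Ioi (0:ℝ))] fun r => (r:ℂ) * (conj (f r) * diffExpr s h r) := by
    filter_upwards [hx, hTy] with r h1 h2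
    rw [h1, h2]
  have e1 : (fun r : ℝ => (r:ℂ) * (conj ((T x) r) * (y : Lp ℂ 2 radialMeasure) r))
      =ᵐ[volume.restrict (Ioi (0:ℝ))] fun r => (r:ℂ) * (conj (diffExpr s f r) * h r) := by
    filter_upwards [hy, hTx] with r h1 h2
    rw [h1, h2]
  rw [inner_rad, inner_rad, integral_congr_ae e1, integral_congr_ae e2]
  exact form_symm s hf hh ((inner_rad_int _ _).congr e2)

lemma T_pos
    (hdom : ∀ F : Lp ℂ 2 radialMeasure,
      F ∈ T.domain ↔ ∃ f : ℝ → ℂ, IsTestFun f ∧ ⇑F =ᵐ[radialMeasure] f)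
    (haction : ∀ (F : T.domain) (f : ℝ → ℂ), IsTestFun f →
      ⇑(F : Lp ℂ 2 radialMeasure) =ᵐ[radialMeasure] f →
      ⇑(T F) =ᵐ[radialMeasure] diffExpr s f) (x : T.domain) :
      0 ≤ (⟪T x, (x : Lp ℂ 2 radialMeasure)⟫).re := by
  obtain ⟨f, hf, hxf⟩ := (hdom x).1 x.2
  have e1 : (fun r : ℝ => (r:ℂ) * (conj ((T x) r) * (x : Lp ℂ 2 radialMeasure) r))
      =ᵐ[volume.restrict (Ioi (0:ℝ))] fun r => (r:ℂ) * (conj (diffExpr s f r) * f r) := by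
    filter_upwards [ae_Ioi_of_rad hxf, ae_Ioi_of_rad (haction x f hf hxf)] with r h1 h2
    rw [h1, h2]
  rw [inner_rad, integral_congr_ae e1]
  exact form_pos s hf ((inner_rad_int _ _).congr e1)

lemma inner_T
    (haction : ∀ (F : T.domain) (f : ℝ → ℂ), IsTestFun f →
      ⇑(F : Lp ℂ 2 radialMeasure) =ᵐ[radialMeasure] f →
      ⇑(T F) =ᵐ[radialMeasure] diffExpr s f) (x : T.domain) {f : ℝ → ℂ} (hf : IsTestFun f)
    (hxf : ⇑(x : Lp ℂ 2 radialMeasure) =ᵐ[radialMeasure] f) (g : Lp ℂ 2 radialMeasure) :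
    ⟪g, T x + (x : Lp ℂ 2 radialMeasure)⟫ =
      ∫ r in Ioi (0:ℝ), conj (g r) * ((r:ℂ) * (diffExpr s f r + f r)) := by
  rw [inner_rad]
  refine integral_congr_ae ?_
  filter_upwards [ae_Ioi_of_rad hxf, ae_Ioi_of_rad (haction x f hf hxf),
    ae_Ioi_of_rad (Lp.coeFn_add (T x) (x : Lp ℂ 2 radialMeasure))] with r h1 h2 h3
  rw [h3, Pi.add_apply, h1, h2]
  ring

lemma w_memLp (hs : |s| < 1) :
    MemLp (fun r => ((uu s r * vv s r : ℝ) : ℂ)) 2 radialMeasure := by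
  have hm : AEStronglyMeasurable (fun r => ((uu s r * vv s r : ℝ) : ℂ)) radialMeasure := by
    refine AEStronglyMeasurable.mono_ac (withDensity_absolutelyContinuous _ _) ?_
    exact (Complex.continuous_ofReal.comp_continuousOn (w_cont s)).aestronglyMeasurable
      measurableSet_Ioi
  rw [memLp_two_iff_integrable_sq_norm hm, integrable_rad_real]
  refine (w_int hs).congr_fun (fun r _ => ?_) measurableSet_Ioi
  simp only [Complex.norm_real, Real.norm_eq_abs, sq_abs]

lemma dir1 (hdom : ∀ F : Lp ℂ 2 radialMeasure,
      F ∈ T.domain ↔ ∃ f : ℝ → ℂ, IsTestFun f ∧ ⇑F =ᵐ[radialMeasure] f)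
    (haction : ∀ (F : T.domain) (f : ℝ → ℂ), IsTestFun f →
      ⇑(F : Lp ℂ 2 radialMeasure) =ᵐ[radialMeasure] f →
      ⇑(T F) =ᵐ[radialMeasure] diffExpr s f)
    (h : ∀ g : Lp ℂ 2 radialMeasure,
      (∀ x : T.domain, ⟪g, T x + (x : Lp ℂ 2 radialMeasure)⟫ = 0) → g = 0) : 1 ≤ |s| := by
  by_contra! hs
  have hg := (w_memLp hs).coeFn_toLp
  have h0 := h ((w_memLp hs).toLp _) (fun x => by
    obtain ⟨f, hf, hxf⟩ := (hdom x).1 x.2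
    rw [inner_T haction x hf hxf, ← w_orth s hf]
    refine integral_congr_ae ?_
    filter_upwards [ae_Ioi_of_rad hg] with r hr
    rw [hr, Complex.conj_ofReal])
  rw [Lp.eq_zero_iff_ae_eq_zero] at h0
  have h1 : ∀ᵐ r ∂radialMeasure, ((uu s r * vv s r : ℝ) : ℂ) = 0 := by
    filter_upwards [hg, h0] with r h1 h2
    rw [← h1, h2]; rfl
  have h2 : ∀ᵐ r ∂(volume.restrict (Ioi (0:ℝ))), False := by
    rw [ae_restrict_iff' measurableSet_Ioi]
    filter_upwards [ae_rad_iff.1 h1] with r hr h0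
    have h3 := hr h0
    rw [Complex.ofReal_eq_zero] at h3
    exact (mul_pos (uu_pos s h0) (vv_pos s h0)).ne' h3
  rw [Filter.eventually_false_iff_eq_bot, ae_eq_bot, Measure.restrict_eq_zero] at h2
  simp at h2

lemma dir2 (hdom : ∀ F : Lp ℂ 2 radialMeasure,
      F ∈ T.domain ↔ ∃ f : ℝ → ℂ, IsTestFun f ∧ ⇑F =ᵐ[radialMeasure] f)
    (haction : ∀ (F : T.domain) (f : ℝ → ℂ), IsTestFun f →
      ⇑(F : Lp ℂ 2 radialMeasure) =ᵐ[radialMeasure] f →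
      ⇑(T F) =ᵐ[radialMeasure] diffExpr s f) (hs : 1 ≤ |s|)
    (g : Lp ℂ 2 radialMeasure)
    (h : ∀ x : T.domain, ⟪g, T x + (x : Lp ℂ 2 radialMeasure)⟫ = 0) : g = 0 := by
  obtain ⟨a, b, hab⟩ := two_dim (kk_smooth s) (fun x hx => kk_pos s hx)
    (fun x hx => vv_deriv s hx) (loc_int_G s g) (fun ψ hψ h0 => by
      obtain ⟨f, hf, hfe⟩ := exists_test s hψ h0
      obtain ⟨F, hF⟩ := dom_of_test hdom hf
      have h4 := h F
      rw [inner_T haction F hf hF] at h4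
      rw [← neg_eq_zero, ← integral_neg, ← h4,
        ← setIntegral_eq_integral_of_forall_compl_eq_zero (s := Ioi (0:ℝ))]
      · refine setIntegral_congr_fun measurableSet_Ioi fun r hr => ?_
        rw [hfe r hr, Complex.real_smul]
        push_cast
        ring
      · intro x hx
        have : deriv ψ x = 0 :=
          image_eq_zero_of_notMem_tsupport fun h => hx (hψ.deriv'.2.2 h)
        rw [this, zero_smul, neg_zero])
  have hab' : ∀ᵐ x : ℝ, x ∈ Ioi (0:ℝ) → conj (g x) = (uu s x : ℂ) * (a + b * vv s x) := by
    filter_upwards [hab] with x hx h0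
    have hu0 : (uu s x:ℂ) ≠ 0 := Complex.ofReal_ne_zero.2 (uu_pos s h0).ne'
    rw [← hx h0]; field_simp
  have hi : IntegrableOn (fun r => r * ‖(uu s r : ℂ) * (a + b * vv s r)‖ ^ 2) (Ioi 0) := by
    have h1 := (memLp_two_iff_integrable_sq_norm (Lp.memLp g).1).1 (Lp.memLp g)
    rw [integrable_rad_real] at h1
    refine h1.congr ?_
    rw [← ae_restrict_iff' measurableSet_Ioi] at hab'
    filter_upwards [hab'] with r hr
    rw [← hr, RCLike.norm_conj]
  have ha := coef_zero hi
  subst ha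
  have hb : b = 0 := by
    by_contra hb
    apply w_not_int hs
    refine (hi.const_mul (‖b‖ ^ 2)⁻¹).congr (Filter.Eventually.of_forall fun r => ?_)
    have : ‖b‖ ≠ 0 := norm_ne_zero_iff.2 hb
    simp only [zero_add, norm_mul, Complex.norm_real, Real.norm_eq_abs, mul_pow, sq_abs]
    field_simp
  subst hb
  rw [Lp.eq_zero_iff_ae_eq_zero]
  refine ae_rad_iff.2 ?_
  filter_upwards [hab'] with x hx h0
  simpa using hx h0

end main

end helpers

theorem essential_selfadjointness_iff (s : ℝ)
    (T : Lp ℂ 2 radialMeasure →ₗ.[ℂ] Lp ℂ 2 radialMeasure)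
    (hdom : ∀ F : Lp ℂ 2 radialMeasure,
      F ∈ T.domain ↔ ∃ f : ℝ → ℂ, IsTestFun f ∧ ⇑F =ᵐ[radialMeasure] f)
    (haction : ∀ (F : T.domain) (f : ℝ → ℂ), IsTestFun f →
      ⇑(F : Lp ℂ 2 radialMeasure) =ᵐ[radialMeasure] f →
      ⇑(T F) =ᵐ[radialMeasure] diffExpr s f) :
    Dense (T.domain : Set (Lp ℂ 2 radialMeasure)) ∧
    (∀ x y : T.domain,
      ⟪T x, (y : Lp ℂ 2 radialMeasure)⟫ = ⟪(x : Lp ℂ 2 radialMeasure), T y⟫) ∧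
    (T.adjoint = T.closure ↔ 1 ≤ |s|) := by
  refine ⟨dom_dense hdom, T_symm hdom haction, ?_⟩
  rw [abstract_esa T (dom_dense hdom) (T_symm hdom haction) (T_pos hdom haction)]
  exact ⟨dir1 hdom haction, fun hs g hg => dir2 hdom haction hs g hg⟩
end
end

section
/- Let H be a complex Hilbert space, M > 0, δ > 0, s > 0, and let B : ℝ → L(H) be a norm-continuous map into the bounded self-adjoint operators on H such that ‖B(τ)‖ ≤ M for all τ ∈ [0, s] and ‖∫₀^σ B(τ) dτ‖ ≤ δσ for all σ ∈ [0, s]. Let C : [0, s] → L(H) be the solution of the operator differential equation C′(σ) = i B(σ) C(σ) with C(0) = id (which exists by the Dyson/Picard iteration and takes unitary values). Then ‖C(s) − id‖ ≤ δ s (1 + M s). -/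
open MeasureTheory intervalIntegral

noncomputable section

/-- Let `B : ℝ → L(H)` be norm-continuous with self-adjoint values,
`‖B(τ)‖ ≤ M` on `[0,s]` and `‖∫₀^σ B‖ ≤ δσ` for `σ ∈ [0,s]`. If `C` solves
`C′(σ) = i B(σ) C(σ)`, `C(0) = id`, then `‖C(s) - id‖ ≤ δ s (1 + M s)`. -/
theorem dyson_propagator_bound
    {H : Type*} [NormedAddCommGroup H] [InnerProductSpace ℂ H] [CompleteSpace H]
    (M δ s : ℝ) (hM : 0 < M) (hδ : 0 < δ) (hs : 0 < s)
    (B : ℝ → H →L[ℂ] H)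
    (hBcont : Continuous B)
    (hBsa : ∀ τ, IsSelfAdjoint (B τ))
    (hBbound : ∀ τ ∈ Set.Icc 0 s, ‖B τ‖ ≤ M)
    (hBint : ∀ σ ∈ Set.Icc 0 s, ‖∫ τ in (0:ℝ)..σ, B τ‖ ≤ δ * σ)
    (C : ℝ → H →L[ℂ] H)
    (hC0 : C 0 = ContinuousLinearMap.id ℂ H)
    (hCode : ∀ σ ∈ Set.Icc 0 s,
      HasDerivAt C (Complex.I • ((B σ).comp (C σ))) σ) :
    ‖C s - ContinuousLinearMap.id ℂ H‖ ≤ δ * s * (1 + M * s) := by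
  have hu : ∀ σ ∈ Set.Icc 0 s, star (C σ) * C σ = 1 := by
    have hd : ∀ σ ∈ Set.Icc 0 s,
        HasDerivWithinAt (fun σ => star (C σ) * C σ) 0 (Set.Icc 0 s) σ := by
      intro σ hσ
      have h := ((hCode σ hσ).star.mul (hCode σ hσ)).hasDerivWithinAt (s := Set.Icc 0 s)
      refine h.congr_deriv ?_
      change star (Complex.I • (B σ * C σ)) * C σ + star (C σ) * (Complex.I • (B σ * C σ)) = 0
      rw [star_smul, star_mul, (hBsa σ).star_eq, smul_mul_assoc, mul_smul_comm, ← mul_assoc]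
      simp
    intro σ hσ
    have h := norm_image_sub_le_of_norm_deriv_le_segment' (C := 0) hd (by simp) σ hσ
    have h2 : star (C σ) * C σ - star (C 0) * C 0 = 0 := by
      rw [← norm_le_zero_iff]; simpa using h
    rw [sub_eq_zero.mp h2, hC0]
    change star (1 : H →L[ℂ] H) * 1 = 1
    simp
  have hn : ∀ σ ∈ Set.Icc 0 s, ‖C σ‖ ≤ 1 := by
    intro σ hσ
    have h1 : ‖C σ‖ * ‖C σ‖ = ‖(1 : H →L[ℂ] H)‖ := by
      rw [← CStarRing.norm_star_mul_self, hu σ hσ]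
    have h2 : ‖(1 : H →L[ℂ] H)‖ ≤ 1 := ContinuousLinearMap.norm_id_le
    nlinarith [norm_nonneg (C σ)]
  set A : ℝ → H →L[ℂ] H := fun σ => ∫ τ in (0:ℝ)..σ, B τ with hA
  have hAd : ∀ σ, HasDerivAt A (B σ) σ := fun σ =>
    hBcont.integral_hasStrictDerivAt 0 σ |>.hasDerivAt
  have hG : ∀ σ ∈ Set.Icc 0 s,
      HasDerivWithinAt (fun σ => C σ - Complex.I • (A σ * C σ)) (A σ * (B σ * C σ))
        (Set.Icc 0 s) σ := by
    intro σ hσ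
    have h := ((hCode σ hσ).sub
      (((hAd σ).mul (hCode σ hσ)).const_smul Complex.I)).hasDerivWithinAt (s := Set.Icc 0 s)
    refine h.congr_deriv ?_
    change Complex.I • (B σ * C σ) -
      Complex.I • (B σ * C σ + A σ * (Complex.I • (B σ * C σ))) = _
    rw [mul_smul_comm, smul_add, smul_smul, Complex.I_mul_I]
    simp
  have hb := norm_image_sub_le_of_norm_deriv_le_segment' (C := δ * s * M) hG (by
    intro σ hσ
    have hσ' : σ ∈ Set.Icc 0 s := ⟨hσ.1, hσ.2.le⟩
    have h1 : ‖A σ‖ ≤ δ * s := (hBint σ hσ').trans (by gcongr; exact hσ.2.le)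
    have h2 : ‖B σ * C σ‖ ≤ M * 1 := (norm_mul_le _ _).trans
      (mul_le_mul (hBbound σ hσ') (hn σ hσ') (norm_nonneg _) hM.le)
    rw [mul_one] at h2
    exact (norm_mul_le _ _).trans (mul_le_mul h1 h2 (norm_nonneg _) (by positivity)))
    s ⟨hs.le, le_rfl⟩
  have hA0 : A 0 = 0 := by simp [hA]
  simp only [hA0, hC0, zero_mul, smul_zero, sub_zero] at hb
  have hs' : s ∈ Set.Icc 0 s := ⟨hs.le, le_rfl⟩
  have h3 : ‖Complex.I • (A s * C s)‖ ≤ δ * s * 1 := by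
    rw [norm_smul, Complex.norm_I, one_mul]
    exact (norm_mul_le _ _).trans
      (mul_le_mul (hBint s hs') (hn s hs') (norm_nonneg _) (by positivity))
  have h4 : C s - ContinuousLinearMap.id ℂ H =
      (C s - Complex.I • (A s * C s) - ContinuousLinearMap.id ℂ H)
        + Complex.I • (A s * C s) := by abel
  rw [h4]
  refine (norm_add_le _ _).trans ((add_le_add hb h3).trans (le_of_eq (by ring)))
end
end
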